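/- Let n ≥ 1, let K ⊆ ℝⁿ be a compact set stable under the coordinate-permutation action of Sₙ, let f : K → ℝ be continuous and Sₙ-invariant, and let ε > 0. Then there exist m₁, m₂ ∈ ℕ, vectors a, b ∈ ℝ^{m₁}, a matrix C ∈ ℝ^{(n+1)×m₁}, a matrix A ∈ ℝ^{m₂×(n+1)}, and vectors d, c ∈ ℝ^{m₂} such that the function N : ℝⁿ → ℝ defined by N(x) = ⟨c, ReLU(A(∑_{i=1}^n C·ReLU(x_i·a + b)) + d)⟩ satisfies sup_{x ∈ K} |f(x) − N(x)| < ε. Moreover, N is Sₙ-invariant: N(σ·x) = N(x) for all σ ∈ Sₙ and x ∈ ℝⁿ. -/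

import Mathlib

/-- One-hidden-layer ReLU networks on the line. -/
def reluSpan1 : Submodule ℝ (ℝ → ℝ) :=
  Submodule.span ℝ (Set.range fun p : ℝ × ℝ => fun t : ℝ => max (t * p.1 + p.2) 0)

/-- One-hidden-layer ReLU networks on `ℝ^ι`. -/
def reluSpan (m : ℕ) : Submodule ℝ ((Fin m → ℝ) → ℝ) :=
  Submodule.span ℝ (Set.range fun p : (Fin m → ℝ) × ℝ =>
    fun y : Fin m → ℝ => max (p.1 ⬝ᵥ y + p.2) 0)

lemma relu1_mem (a b : ℝ) : (fun t : ℝ => max (t * a + b) 0) ∈ reluSpan1 :=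
  Submodule.subset_span ⟨(a, b), rfl⟩

lemma const1_mem (c : ℝ) : (fun _ : ℝ => c) ∈ reluSpan1 := by
  have h := reluSpan1.smul_mem c (relu1_mem 0 1)
  convert h using 1
  ext t
  simp

lemma ridge_mem {m : ℕ} (w : Fin m → ℝ) {g : ℝ → ℝ} (hg : g ∈ reluSpan1) :
    (fun y : Fin m → ℝ => g (w ⬝ᵥ y)) ∈ reluSpan m := by
  unfold reluSpan1 at hg
  induction hg using Submodule.span_induction with
  | mem g hg =>
    obtain ⟨⟨a, b⟩, rfl⟩ := hg
    refine Submodule.subset_span ⟨(a • w, b), ?_⟩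
    ext y
    simp [mul_comm]
  | zero => exact (reluSpan m).zero_mem
  | add f g _ _ hf hg => exact (reluSpan m).add_mem hf hg
  | smul c f _ hf => exact (reluSpan m).smul_mem c hf

lemma reluSpan_continuous {m : ℕ} {G : (Fin m → ℝ) → ℝ} (hG : G ∈ reluSpan m) :
    Continuous G := by
  unfold reluSpan at hG
  induction hG using Submodule.span_induction with
  | mem g hg =>
    obtain ⟨⟨a, b⟩, rfl⟩ := hg
    simp only [dotProduct]
    fun_prop
  | zero => exact continuous_const
  | add f g _ _ hf hg => exact hf.add hg
  | smul c f _ hf => exact hf.const_smul c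

/-- The unit ramp between `s` and `s + h`. -/
lemma ramp_mem (s h : ℝ) (hh : 0 < h) : ∃ ψ ∈ reluSpan1, (∀ t, t ≤ s → ψ t = 0) ∧
    (∀ t, s + h ≤ t → ψ t = 1) ∧ (∀ t, 0 ≤ ψ t ∧ ψ t ≤ 1) := by
  refine ⟨_, reluSpan1.smul_mem h⁻¹ (reluSpan1.sub_mem (relu1_mem 1 (-s)) (relu1_mem 1 (-(s+h)))),
    ?_, ?_, ?_⟩
  · intro t ht
    simp only [Pi.smul_apply, Pi.sub_apply, smul_eq_mul]
    rw [max_eq_right (by linarith), max_eq_right (by linarith)]; simp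
  · intro t ht
    simp only [Pi.smul_apply, Pi.sub_apply, smul_eq_mul]
    rw [max_eq_left (by linarith), max_eq_left (by linarith)]; field_simp; ring
  · intro t
    simp only [Pi.smul_apply, Pi.sub_apply, smul_eq_mul]
    rw [inv_mul_eq_div]
    constructor
    · apply div_nonneg _ hh.le
      have : max (t * 1 + -(s+h)) 0 ≤ max (t * 1 + -s) 0 := max_le_max (by linarith) le_rfl
      linarith
    · rw [div_le_one hh]
      have : max (t * 1 + -s) 0 ≤ max (t * 1 + -(s+h)) 0 + h := by
        apply max_le
        · linarith [le_max_left (t * 1 + -(s+h)) 0]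
        · linarith [le_max_right (t * 1 + -(s+h)) 0]
      linarith

lemma approx1 (φ : ℝ → ℝ) (hφ : Continuous φ) (M ε : ℝ) (hε : 0 < ε) :
    ∃ g ∈ reluSpan1, ∀ t, |t| ≤ M → |φ t - g t| < ε := by
  have hc : IsCompact (Set.Icc (-M) M) := isCompact_Icc
  have hu := hc.uniformContinuousAt_of_continuousAt φ (fun a _ => hφ.continuousAt)
    (Metric.dist_mem_uniformity (half_pos hε))
  obtain ⟨δ, hδ, hu⟩ := Metric.mem_uniformity_dist.1 hu
  have hu' : ∀ s t, -M ≤ s → s ≤ M → |s - t| < δ → |φ s - φ t| < ε / 2 := by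
    intro s t h1 h2 h3
    have := @hu s t h3
    exact this ⟨h1, h2⟩
  set h := δ / 2 with hh
  have hhp : 0 < h := by positivity
  have key : ∀ k : ℕ, ∃ g ∈ reluSpan1,
      (∀ t, -M ≤ t → t ≤ M → t ≤ -M + k * h → |φ t - g t| < ε) ∧
      (∀ t, -M + k * h ≤ t → g t = φ (-M + k * h)) := by
    intro k
    induction k with
    | zero =>
      refine ⟨_, const1_mem (φ (-M)), ?_, ?_⟩
      · intro t h1 h2 h3
        have : t = -M := by simp at h3; linarith
        simp [this, hε]
      · intro t _; simp
    | succ k ih =>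
      obtain ⟨g, hg, h1, h2⟩ := ih
      obtain ⟨ψ, hψ, p0, p1, p01⟩ := ramp_mem (-M + k * h) h hhp
      set s := -M + k * h with hs
      have hs' : -M + ((k + 1 : ℕ) : ℝ) * h = s + h := by push_cast; rw [hs]; ring
      rw [hs']
      refine ⟨_, reluSpan1.add_mem hg (reluSpan1.smul_mem (φ (s + h) - φ s) hψ), ?_, ?_⟩
      · intro t t1 t2 t3
        simp only [Pi.add_apply, Pi.smul_apply, smul_eq_mul]
        rcases le_total t s with hts | hts
        · rw [p0 t hts]; simpa using h1 t t1 t2 hts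
        · rw [h2 t hts]
          have e1 := abs_lt.1 (hu' t s t1 t2 (by rw [abs_lt]; constructor <;> linarith))
          have e2 := abs_lt.1 (hu' t (s + h) t1 t2 (by rw [abs_lt]; constructor <;> linarith))
          obtain ⟨q0, q1⟩ := p01 t
          have : φ t - (φ s + (φ (s + h) - φ s) * ψ t) =
            (1 - ψ t) * (φ t - φ s) + ψ t * (φ t - φ (s + h)) := by ring
          rw [this, abs_lt]
          constructor <;> nlinarith
      · intro t ht
        simp only [Pi.add_apply, Pi.smul_apply, smul_eq_mul]
        rw [h2 t (by linarith), p1 t ht]; ring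
  obtain ⟨k, hk⟩ := exists_nat_gt (2 * M / h)
  rw [div_lt_iff₀ hhp] at hk
  obtain ⟨g, hg, h1, -⟩ := key k
  refine ⟨g, hg, fun t ht => ?_⟩
  rw [abs_le] at ht
  exact h1 t ht.1 ht.2 (by linarith)

/-- The exponential ridge functions. -/
noncomputable def expHom (m : ℕ) (S : Set (Fin m → ℝ)) : Multiplicative (Fin m → ℝ) →* C(S, ℝ) where
  toFun w := ⟨fun y => Real.exp (w.toAdd ⬝ᵥ y.1), by
    refine Real.continuous_exp.comp ?_
    exact continuous_finsetSum _ fun i _ =>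
      continuous_const.mul ((continuous_apply i).comp continuous_subtype_val)⟩
  map_one' := by ext y; simp
  map_mul' v w := by ext y; simp [add_dotProduct, Real.exp_add]

lemma approxm {m : ℕ} (S : Set (Fin m → ℝ)) (hS : IsCompact S) (g : S → ℝ) (hg : Continuous g)
    (ε : ℝ) (hε : 0 < ε) : ∃ G ∈ reluSpan m, ∀ y : S, |g y - G y| < ε := by
  have : CompactSpace S := isCompact_iff_compactSpace.1 hS
  let A : Subalgebra ℝ C(S, ℝ) := Algebra.adjoin ℝ (MonoidHom.mrange (expHom m S) : Set C(S, ℝ))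
  have hsep : A.SeparatesPoints := by
    intro x y hxy
    have : ∃ j, x.1 j ≠ y.1 j := by
      by_contra! hcon
      exact hxy (Subtype.ext (funext hcon))
    obtain ⟨j, hj⟩ := this
    refine ⟨_, ⟨expHom m S (Multiplicative.ofAdd (Pi.single j 1)),
      Algebra.subset_adjoin ⟨_, rfl⟩, rfl⟩, ?_⟩
    simpa [expHom] using hj
  obtain ⟨⟨h, hA⟩, hh⟩ := ContinuousMap.exists_mem_subalgebra_near_continuous_of_separatesPoints
    A hsep g hg (ε / 2) (half_pos hε)
  have hA' : h ∈ Submodule.span ℝ (MonoidHom.mrange (expHom m S) : Set C(S, ℝ)) := by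
    have := Algebra.adjoin_eq_span (R := ℝ) (MonoidHom.mrange (expHom m S) : Set C(S, ℝ))
    rw [Submonoid.closure_eq] at this
    rw [← this]; exact hA
  have key : ∀ h ∈ Submodule.span ℝ (MonoidHom.mrange (expHom m S) : Set C(S, ℝ)),
      ∀ ε > 0, ∃ G ∈ reluSpan m, ∀ y : S, |h y - G y| < ε := by
    intro h hh
    induction hh using Submodule.span_induction with
    | mem h hh =>
      intro ε hε
      obtain ⟨w, rfl⟩ := hh
      have hb : ∃ M, ∀ y ∈ S, |w.toAdd ⬝ᵥ y| ≤ M := by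
        have := hS.exists_bound_of_continuousOn (f := fun y => w.toAdd ⬝ᵥ y)
          (by simp only [dotProduct]; fun_prop)
        simpa using this
      obtain ⟨M, hM⟩ := hb
      obtain ⟨e, he, hee⟩ := approx1 Real.exp Real.continuous_exp M ε hε
      exact ⟨_, ridge_mem w.toAdd he, fun y => hee _ (hM y.1 y.2)⟩
    | zero => intro ε hε; exact ⟨0, zero_mem _, fun y => by simpa using hε⟩
    | add f g _ _ hf hg =>
      intro ε hε
      obtain ⟨F, hF, hF'⟩ := hf (ε / 2) (half_pos hε)
      obtain ⟨G, hG, hG'⟩ := hg (ε / 2) (half_pos hε)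
      refine ⟨_, add_mem hF hG, fun y => ?_⟩
      have e1 := abs_lt.1 (hF' y)
      have e2 := abs_lt.1 (hG' y)
      simp only [ContinuousMap.add_apply, Pi.add_apply]
      rw [abs_lt]; constructor <;> linarith
    | smul c f _ hf =>
      intro ε hε
      obtain ⟨F, hF, hF'⟩ := hf (ε / (|c| + 1)) (by positivity)
      refine ⟨_, (reluSpan m).smul_mem c hF, fun y => ?_⟩
      have e1 := hF' y
      rw [lt_div_iff₀ (by positivity)] at e1
      simp only [ContinuousMap.smul_apply, Pi.smul_apply, smul_eq_mul]
      rw [← mul_sub, abs_mul]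
      nlinarith [abs_nonneg (f y - F y), abs_nonneg c]
  obtain ⟨G, hG, hG'⟩ := key h hA' (ε / 2) (half_pos hε)
  refine ⟨G, hG, fun y => ?_⟩
  have e1 := abs_lt.1 (hG' y)
  have e2 := hh y
  rw [Real.norm_eq_abs] at e2
  have e2 := abs_lt.1 e2
  simp only at e2
  rw [abs_lt]; constructor <;> linarith

lemma psum_inj {n : ℕ} (x y : Fin n → ℝ) (h : ∀ k ≤ n, ∑ i, x i ^ k = ∑ i, y i ^ k) :
    ∃ σ : Equiv.Perm (Fin n), ∀ i, y (σ i) = x i := by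
  have he : ∀ k ≤ n, MvPolynomial.aeval x (MvPolynomial.esymm (Fin n) ℝ k) =
      MvPolynomial.aeval y (MvPolynomial.esymm (Fin n) ℝ k) := by
    intro k
    induction k using Nat.strong_induction_on with
    | _ k ih =>
    intro hk
    rcases Nat.eq_zero_or_pos k with rfl | hkp
    · simp
    have hN := MvPolynomial.mul_esymm_eq_sum (Fin n) ℝ k
    have hx := congrArg (MvPolynomial.aeval x) hN
    have hy := congrArg (MvPolynomial.aeval y) hN
    simp only [map_mul, map_natCast, map_pow, map_neg, map_one, map_sum] at hx hy
    have : (k : ℝ) ≠ 0 := by positivity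
    apply mul_left_cancel₀ this
    rw [hx, hy]
    congr 1
    apply Finset.sum_congr rfl
    intro a ha
    rw [Finset.mem_filter] at ha
    have ha1 := Finset.HasAntidiagonal.mem_antidiagonal.1 ha.1
    rw [ih a.1 ha.2 (by omega)]
    congr 1
    simpa [MvPolynomial.psum] using h a.2 (by omega)
  have hm : (Finset.univ.val.map x) = (Finset.univ.val.map y) := by
    rw [← Polynomial.roots_multiset_prod_X_sub_C (Finset.univ.val.map x),
      ← Polynomial.roots_multiset_prod_X_sub_C (Finset.univ.val.map y)]
    congr 1
    rw [Multiset.prod_X_sub_X_eq_sum_esymm, Multiset.prod_X_sub_X_eq_sum_esymm]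
    simp only [Multiset.card_map]
    apply Finset.sum_congr rfl
    intro j hj
    have hj : j ≤ n := by simpa [Nat.lt_succ_iff] using hj
    have := he j hj
    rw [MvPolynomial.aeval_esymm_eq_multiset_esymm, MvPolynomial.aeval_esymm_eq_multiset_esymm]
      at this
    rw [this]
  classical
  have hcard : ∀ v, Nonempty ({i // x i = v} ≃ {i // y i = v}) := by
    intro v
    apply Fintype.card_eq.1
    have := congrArg (Multiset.count v) hm
    rw [Multiset.count_map, Multiset.count_map] at this
    rw [Fintype.card_subtype, Fintype.card_subtype]
    simpa [Finset.card_def, Finset.filter_val, eq_comm] using this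
  let e : ∀ v, {i // x i = v} ≃ {i // y i = v} := fun v => (hcard v).some
  refine ⟨(Equiv.sigmaFiberEquiv x).symm.trans
    ((Equiv.sigmaCongrRight e).trans (Equiv.sigmaFiberEquiv y)), fun i => ?_⟩
  exact (e (x i) ⟨i, rfl⟩).2

lemma exists_net1 {m : ℕ} (e : Fin m → ℝ → ℝ) (he : ∀ j, e j ∈ reluSpan1) :
    ∃ (m₁ : ℕ) (a b : Fin m₁ → ℝ) (C : Matrix (Fin m) (Fin m₁) ℝ),
      ∀ t j, e j t = C.mulVec (fun p => max (t * a p + b p) 0) j := by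
  classical
  have h : ∀ j, ∃ l : (ℝ × ℝ) →₀ ℝ,
      (l.sum fun i a => a • (fun t : ℝ => max (t * i.1 + i.2) 0)) = e j :=
    fun j => Finsupp.mem_span_range_iff_exists_finsupp.1 (he j)
  choose l hl using h
  let s : Finset (ℝ × ℝ) := Finset.univ.biUnion fun j => (l j).support
  let q := s.equivFin.symm
  refine ⟨s.card, fun p => (q p).1.1, fun p => (q p).1.2, fun j p => l j (q p).1, fun t j => ?_⟩
  rw [← hl j, Finsupp.sum_of_support_subset (s := s) _ _ _ (by simp), Finset.sum_apply]
  · simp only [Matrix.mulVec, dotProduct, Pi.smul_apply, smul_eq_mul]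
    rw [Equiv.sum_comp q (fun p : s => l j p.1 * max (t * p.1.1 + p.1.2) 0),
      Finset.sum_coe_sort s (fun p => l j p * max (t * p.1 + p.2) 0)]
  · exact Finset.subset_biUnion_of_mem (fun j => (l j).support) (Finset.mem_univ j)

lemma exists_net {m : ℕ} (G : (Fin m → ℝ) → ℝ) (hG : G ∈ reluSpan m) :
    ∃ (m₂ : ℕ) (A : Matrix (Fin m₂) (Fin m) ℝ) (d c : Fin m₂ → ℝ),
      ∀ y, G y = ∑ k, c k * max ((A.mulVec y + d) k) 0 := by
  classical
  obtain ⟨l, hl⟩ := Finsupp.mem_span_range_iff_exists_finsupp.1 hG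
  let q := l.support.equivFin.symm
  refine ⟨l.support.card, fun p => (q p).1.1, fun p => (q p).1.2, fun p => l (q p).1, fun y => ?_⟩
  rw [← hl, Finsupp.sum, Finset.sum_apply]
  simp only [Matrix.mulVec, Pi.add_apply, Pi.smul_apply, smul_eq_mul]
  rw [Equiv.sum_comp q (fun p : l.support => l p.1 * max (p.1.1 ⬝ᵥ y + p.1.2) 0),
      Finset.sum_coe_sort l.support (fun p => l p * max (p.1 ⬝ᵥ y + p.2) 0)]


/-- universal approximation of `Sₙ`-invariant functions by
`Sₙ`-invariant ReLU networks.  For compact `Sₙ`-stable `K ⊆ ℝⁿ`, continuous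
`Sₙ`-invariant `f : K → ℝ` and `ε > 0`, there are widths `m₁, m₂`, vectors
`a, b ∈ ℝ^{m₁}`, matrices `C ∈ ℝ^{(n+1)×m₁}`, `A ∈ ℝ^{m₂×(n+1)}` and vectors
`d, c ∈ ℝ^{m₂}` such that
`N x = ⟨c, ReLU (A (∑ᵢ C ReLU (xᵢ a + b)) + d)⟩`
satisfies `|f x − N x| < ε` on `K`, and `N` is `Sₙ`-invariant. -/
theorem stmt14 (n : ℕ) (hn : 1 ≤ n) (K : Set (Fin n → ℝ)) (hK : IsCompact K)
    (hstab : ∀ σ : Equiv.Perm (Fin n), ∀ x ∈ K, (fun i => x (σ⁻¹ i)) ∈ K)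
    (f : (Fin n → ℝ) → ℝ) (hf : ContinuousOn f K)
    (hinv : ∀ σ : Equiv.Perm (Fin n), ∀ x ∈ K, f (fun i => x (σ⁻¹ i)) = f x)
    (ε : ℝ) (hε : 0 < ε) :
    ∃ (m₁ m₂ : ℕ) (a b : Fin m₁ → ℝ) (C : Matrix (Fin (n + 1)) (Fin m₁) ℝ)
      (A : Matrix (Fin m₂) (Fin (n + 1)) ℝ) (d c : Fin m₂ → ℝ)
      (N : (Fin n → ℝ) → ℝ),
      (∀ x : Fin n → ℝ, N x =
        ∑ k : Fin m₂, c k *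
          max ((A.mulVec (∑ i : Fin n,
            C.mulVec (fun p => max (x i * a p + b p) 0)) + d) k) 0) ∧
      (∀ x ∈ K, |f x - N x| < ε) ∧
      (∀ (σ : Equiv.Perm (Fin n)) (x : Fin n → ℝ),
        N (fun i => x (σ⁻¹ i)) = N x) := by
  let Φ : (Fin n → ℝ) → (Fin (n + 1) → ℝ) := fun x j => ∑ i, x i ^ (j : ℕ)
  have hΦ : Continuous Φ := by fun_prop
  have hfac : ∀ x ∈ K, ∀ y ∈ K, Φ x = Φ y → f x = f y := by
    intro x hx y hy hxy
    obtain ⟨σ, hσ⟩ := psum_inj x y (fun k hk => congrFun hxy ⟨k, by omega⟩)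
    rw [← hinv σ⁻¹ y hy]
    congr 1
    ext i
    simp [hσ]
  have hS : IsCompact (Φ '' K) := hK.image hΦ
  have : CompactSpace K := isCompact_iff_compactSpace.1 hK
  let Ψ : K → Φ '' K := fun x => ⟨Φ x, x, x.2, rfl⟩
  have hΨc : Continuous Ψ := by fun_prop
  have hΨs : Function.Surjective Ψ := by
    rintro ⟨_, x, hx, rfl⟩
    exact ⟨⟨x, hx⟩, rfl⟩
  have hq : Topology.IsQuotientMap Ψ := hΨc.isClosedMap.isQuotientMap hΨc hΨs
  choose r hr using hΨs
  let g : Φ '' K → ℝ := fun y => f (r y)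
  have hgΨ : ∀ x : K, g (Ψ x) = f x := fun x =>
    hfac _ (r (Ψ x)).2 _ x.2 (congrArg Subtype.val (hr (Ψ x)))
  have hg : Continuous g := by
    rw [hq.continuous_iff]
    have : g ∘ Ψ = fun x : K => f x := funext hgΨ
    rw [this]
    exact continuousOn_iff_continuous_domRestrict.1 hf
  obtain ⟨G, hG, hGg⟩ := approxm (Φ '' K) hS g hg (ε / 2) (half_pos hε)
  have hGc := reluSpan_continuous hG
  have hu := hS.uniformContinuousAt_of_continuousAt G (fun a _ => hGc.continuousAt)
    (Metric.dist_mem_uniformity (half_pos hε))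
  obtain ⟨δ, hδ, hu⟩ := Metric.mem_uniformity_dist.1 hu
  obtain ⟨M, hM⟩ := hK.exists_bound_of_continuousOn (f := fun x => x) continuousOn_id
  have hn0 : (0 : ℝ) < n := by exact_mod_cast hn
  choose e he hee using fun j : Fin (n + 1) =>
    approx1 (fun t => t ^ (j : ℕ)) (by fun_prop) M (δ / n) (by positivity)
  obtain ⟨m₁, a, b, C, hC⟩ := exists_net1 e he
  obtain ⟨m₂, A, d, c, hA⟩ := exists_net G hG
  have hsum : ∀ x : Fin n → ℝ, (∑ i : Fin n, C.mulVec (fun p => max (x i * a p + b p) 0)) =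
      fun j => ∑ i, e j (x i) := by
    intro x
    ext j
    rw [Finset.sum_apply]
    exact Finset.sum_congr rfl fun i _ => (hC _ _).symm
  refine ⟨m₁, m₂, a, b, C, A, d, c, fun x => G (fun j => ∑ i, e j (x i)), ?_, ?_, ?_⟩
  · intro x
    rw [hsum]
    exact hA _
  · intro x hx
    have e1 := abs_lt.1 (hGg (Ψ ⟨x, hx⟩))
    rw [hgΨ] at e1
    have hd : dist (Φ x) (fun j => ∑ i, e j (x i)) < δ := by
      rw [dist_pi_lt_iff hδ]
      intro j
      rw [Real.dist_eq, ← Finset.sum_sub_distrib]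
      calc |∑ i, (x i ^ (j : ℕ) - e j (x i))| ≤ ∑ i, |x i ^ (j : ℕ) - e j (x i)| :=
            Finset.abs_sum_le_sum_abs _ _
        _ < ∑ i : Fin n, δ / n := by
            apply Finset.sum_lt_sum_of_nonempty
            · exact ⟨⟨0, hn⟩, Finset.mem_univ _⟩
            · intro i _
              exact hee j (x i) ((norm_le_pi_norm x i).trans (hM x hx))
        _ = δ := by simp; field_simp
    have e2 : dist (G (Φ x)) (G (fun j => ∑ i, e j (x i))) < ε / 2 := hu hd ⟨x, hx, rfl⟩
    rw [Real.dist_eq] at e2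
    have e2 := abs_lt.1 e2
    simp only [Ψ] at e1
    rw [abs_lt]; constructor <;> linarith
  · intro σ x
    have : (fun j => ∑ i, e j (x (σ⁻¹ i))) = fun j => ∑ i, e j (x i) := by
      ext j
      exact Equiv.sum_comp σ⁻¹ (fun i => e j (x i))
    exact congrArg G this
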